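/- Let a and b be non-adjacent vertices of P with M = M_{a,b} not an edge of T, and let T_{i_0}, c, d, T_{i_1}, T_{i_1'}, L, L' be as in the setup. Then in the field F one has (∑_{α ∈ 𝒫_T(a,b)} x(α)) · x_{i_0} = x_{i_1} · (∑_{γ ∈ 𝒫_T(c,b)} x(γ)) + x_{i_1'} · (∑_{γ ∈ 𝒫_T(d,b)} x(γ)). (This is the exchange-relation form of Theorem 1: the sum ∑_{α ∈ 𝒫_T(a,b)} x(α) equals the cluster variable x_M of the Ptolemy cluster algebra.) -/

import Mathlib

open scoped BigOperators Classical

noncomputable section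

/-- The `k`-th vertex of the regular `(n+3)`-gon inscribed in the unit circle. -/
def vtx (n : ℕ) (k : Fin (n + 3)) : EuclideanSpace ℝ (Fin 2) :=
  (WithLp.equiv 2 (Fin 2 → ℝ)).symm
    ![Real.cos (2 * Real.pi * k / (n + 3)), Real.sin (2 * Real.pi * k / (n + 3))]

/-- `u` and `v` are cyclically adjacent vertices of the `(n+3)`-gon. -/
def Adj (n : ℕ) (u v : Fin (n + 3)) : Prop :=
  (u.val + 1) % (n + 3) = v.val ∨ (v.val + 1) % (n + 3) = u.val

/-- The pair `(u, v)` is a diagonal of the polygon. -/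
def IsDiag (n : ℕ) (u v : Fin (n + 3)) : Prop :=
  u ≠ v ∧ ¬ Adj n u v

/-- The open segments joining `u,v` and `w,z` intersect (the two edges cross). -/
def Cross (n : ℕ) (u v w z : Fin (n + 3)) : Prop :=
  (openSegment ℝ (vtx n u) (vtx n v) ∩ openSegment ℝ (vtx n w) (vtx n z)).Nonempty

/-- `(u,v)` and `(w,z)` are the same unordered pair of vertices. -/
def SamePair (n : ℕ) (u v w z : Fin (n + 3)) : Prop :=
  (u = w ∧ v = z) ∨ (u = z ∧ v = w)

/-- A triangulation of the `(n+3)`-gon: `2n+3` edges, the first `n` of which are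
pairwise noncrossing diagonals (a maximal such family), and the remaining `n+3`
are the boundary edges. -/
structure Triangulation (n : ℕ) where
  src : Fin (2 * n + 3) → Fin (n + 3)
  tgt : Fin (2 * n + 3) → Fin (n + 3)
  diag : ∀ i : Fin (2 * n + 3), i.val < n → IsDiag n (src i) (tgt i)
  bdry : ∀ i : Fin (2 * n + 3), n ≤ i.val → Adj n (src i) (tgt i)
  inj : ∀ i j : Fin (2 * n + 3), SamePair n (src i) (tgt i) (src j) (tgt j) → i = j
  noncross : ∀ i j : Fin (2 * n + 3), i ≠ j → ¬ Cross n (src i) (tgt i) (src j) (tgt j)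
  bdry_complete : ∀ u v : Fin (n + 3), Adj n u v →
    ∃ i : Fin (2 * n + 3), n ≤ i.val ∧ SamePair n (src i) (tgt i) u v
  maximal : ∀ u v : Fin (n + 3), IsDiag n u v →
    (∀ i : Fin (2 * n + 3), i.val < n → ¬ Cross n u v (src i) (tgt i)) →
    ∃ i : Fin (2 * n + 3), i.val < n ∧ SamePair n (src i) (tgt i) u v

/-- The edge `T_i` joins the vertices `u` and `v`. -/
def Joins (n : ℕ) (T : Triangulation n) (i : Fin (2 * n + 3)) (u v : Fin (n + 3)) : Prop :=
  SamePair n (T.src i) (T.tgt i) u v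

/-- The edge `T_i` crosses the segment from `u` to `v`. -/
def ECross (n : ℕ) (T : Triangulation n) (i : Fin (2 * n + 3)) (u v : Fin (n + 3)) : Prop :=
  Cross n (T.src i) (T.tgt i) u v

/-- The set of crossing points of the edge `T_i` with the segment from `u` to `v`. -/
def crossPts (n : ℕ) (T : Triangulation n) (i : Fin (2 * n + 3)) (u v : Fin (n + 3)) :
    Set (EuclideanSpace ℝ (Fin 2)) :=
  openSegment ℝ (vtx n (T.src i)) (vtx n (T.tgt i)) ∩ openSegment ℝ (vtx n u) (vtx n v)

/-- A default edge index. -/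
def edef (n : ℕ) : Fin (2 * n + 3) := ⟨0, by omega⟩

/-- The data of a path: the list of vertices `a_0,…,a_ℓ` and the list of
edge indices `i_1,…,i_ℓ`. -/
abbrev PathData (n : ℕ) := List (Fin (n + 3)) × List (Fin (2 * n + 3))

/-- `p` is a `T`-path from `a` to `b`: conditions (T1)–(T6). -/
def IsTPath (n : ℕ) (T : Triangulation n) (a b : Fin (n + 3)) (p : PathData n) : Prop :=
  -- the vertex list has one more entry than the edge list
  p.1.length = p.2.length + 1 ∧
  -- (T1)
  p.1.head? = some a ∧ p.1.getLast? = some b ∧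
  -- (T2)
  (∀ k, k < p.2.length →
      Joins n T (p.2.getD k (edef n)) (p.1.getD k a) (p.1.getD (k + 1) a)) ∧
  -- (T3)
  p.2.Nodup ∧
  -- (T4)
  Odd p.2.length ∧
  -- (T5) (list position `k` carries the `(k+1)`-st edge of the path)
  (∀ k, k < p.2.length → k % 2 = 1 → ECross n T (p.2.getD k (edef n)) a b) ∧
  -- (T6)
  (∀ j k, j < k → k < p.2.length →
      ∀ x ∈ crossPts n T (p.2.getD j (edef n)) a b,
      ∀ y ∈ crossPts n T (p.2.getD k (edef n)) a b,
        dist (vtx n a) x < dist (vtx n a) y)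

/-- `𝒫_T(a,b)`: the set of `T`-paths from `a` to `b`. -/
def TPaths (n : ℕ) (T : Triangulation n) (a b : Fin (n + 3)) : Set (PathData n) :=
  { p | IsTPath n T a b p }

/-- `𝒫_T(a,b)_j`: `T`-paths from `a` to `b` whose first edge is `T_j`. -/
def TPathsFirst (n : ℕ) (T : Triangulation n) (a b : Fin (n + 3)) (j : Fin (2 * n + 3)) :
    Set (PathData n) :=
  { p ∈ TPaths n T a b | p.2.head? = some j }

/-- `𝒫_T(a,b)_{-j}`: `T`-paths from `a` to `b` not containing the index `j`. -/
def TPathsAvoid (n : ℕ) (T : Triangulation n) (a b : Fin (n + 3)) (j : Fin (2 * n + 3)) :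
    Set (PathData n) :=
  { p ∈ TPaths n T a b | j ∉ p.2 }

/-- `𝒫_T(a,b)_{jk}`: `T`-paths from `a` to `b` whose first two edges are `T_j, T_k`. -/
def TPathsFirst2 (n : ℕ) (T : Triangulation n) (a b : Fin (n + 3))
    (j k : Fin (2 * n + 3)) : Set (PathData n) :=
  { p ∈ TPathsFirst n T a b j | p.2[1]? = some k }

/-- `𝒫_T(a,b)_{j,-k}`: `T`-paths from `a` to `b` whose first edge is `T_j` and which do
not contain the index `k`. -/
def TPathsFirstAvoid (n : ℕ) (T : Triangulation n) (a b : Fin (n + 3))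
    (j k : Fin (2 * n + 3)) : Set (PathData n) :=
  { p ∈ TPathsFirst n T a b j | k ∉ p.2 }

/-- The ambient field `F = ℚ(x_1,…,x_{2n+3})`. -/
abbrev F (n : ℕ) := FractionRing (MvPolynomial (Fin (2 * n + 3)) ℚ)

/-- The variable `x_i ∈ F` attached to the edge `T_i`. -/
def X (n : ℕ) (i : Fin (2 * n + 3)) : F n :=
  algebraMap (MvPolynomial (Fin (2 * n + 3)) ℚ) (F n) (MvPolynomial.X i)

/-- `x(α)` for a path with edge list `es = [i_1,…,i_ℓ]`: the product of the
variables of the odd edges times the inverse of the product of the variables of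
the even edges (list position `k` carries the `(k+1)`-st edge). -/
def pathX (n : ℕ) (es : List (Fin (2 * n + 3))) : F n :=
  (∏ k ∈ (Finset.range es.length).filter (fun k => k % 2 = 0), X n (es.getD k (edef n))) *
  (∏ k ∈ (Finset.range es.length).filter (fun k => k % 2 = 1), X n (es.getD k (edef n)))⁻¹

end

/-- Twice the signed area of the triangle `PQR` in the plane. -/
def signedArea (P Q R : EuclideanSpace ℝ (Fin 2)) : ℝ :=
  (Q 0 - P 0) * (R 1 - P 1) - (Q 1 - P 1) * (R 0 - P 0)

lemma signedArea_combo (P Q R S : EuclideanSpace ℝ (Fin 2)) {s t : ℝ} (h : s + t = 1) :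
    signedArea P Q (s • R + t • S) = s * signedArea P Q R + t * signedArea P Q S := by
  obtain rfl : s = 1 - t := by linarith
  simp only [signedArea, PiLp.add_apply, PiLp.smul_apply, smul_eq_mul]
  ring

lemma signedArea_self_left (P Q : EuclideanSpace ℝ (Fin 2)) : signedArea P Q P = 0 := by
  simp [signedArea]

lemma signedArea_self_right (P Q : EuclideanSpace ℝ (Fin 2)) : signedArea P Q Q = 0 := by
  simp only [signedArea]; ring

lemma signedArea_rotate (P Q R : EuclideanSpace ℝ (Fin 2)) :
    signedArea P Q R = signedArea Q R P := by
  simp only [signedArea]; ring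

lemma signedArea_swap (P Q R : EuclideanSpace ℝ (Fin 2)) :
    signedArea P Q R = -signedArea P R Q := by
  simp only [signedArea]; ring

lemma signedArea_eq_zero_of_mem_openSegment {P Q x : EuclideanSpace ℝ (Fin 2)}
    (hx : x ∈ openSegment ℝ P Q) : signedArea P Q x = 0 := by
  obtain ⟨s, t, -, -, hst, rfl⟩ := hx
  rw [signedArea_combo _ _ _ _ hst, signedArea_self_left, signedArea_self_right]
  simp

lemma signedArea_vtx_pos (n : ℕ) {u v w : Fin (n + 3)} (huv : u < v) (hvw : v < w) :
    0 < signedArea (vtx n u) (vtx n v) (vtx n w) := by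
  have hN : (0 : ℝ) < n + 3 := by positivity
  have half : ∀ x y : Fin (n + 3), x < y →
      0 < Real.sin (Real.pi * (y - x) / (n + 3)) := by
    intro x y hxy
    have h1 : (x : ℝ) < y := by exact_mod_cast hxy
    have h2 : (y : ℝ) < n + 3 := by exact_mod_cast y.isLt
    have h3 : (0 : ℝ) ≤ x := by positivity
    apply Real.sin_pos_of_pos_of_lt_pi
    · exact div_pos (mul_pos Real.pi_pos (by linarith)) hN
    · rw [div_lt_iff₀ hN]
      exact mul_lt_mul_of_pos_left (by linarith) Real.pi_pos
  have h1 := half u v huv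
  have h2 := half v w hvw
  have h3 := half u w (huv.trans hvw)
  have key : signedArea (vtx n u) (vtx n v) (vtx n w) =
      4 * Real.sin (Real.pi * (v - u) / (n + 3)) * Real.sin (Real.pi * (w - v) / (n + 3)) *
        Real.sin (Real.pi * (w - u) / (n + 3)) := by
    have e1 : Real.pi * (w - u) / (n + 3) =
        Real.pi * (v - u) / (n + 3) + Real.pi * (w - v) / ((n : ℝ) + 3) := by ring
    have ev : 2 * Real.pi * v / (n + 3) =
        2 * Real.pi * u / (n + 3) + 2 * (Real.pi * (v - u) / ((n : ℝ) + 3)) := by ring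
    have ew : 2 * Real.pi * w / (n + 3) = 2 * Real.pi * u / (n + 3) +
        (2 * (Real.pi * (v - u) / (n + 3)) + 2 * (Real.pi * (w - v) / ((n : ℝ) + 3))) := by ring
    simp only [signedArea, vtx, WithLp.equiv_symm_apply, Matrix.cons_val_zero, Matrix.cons_val_one]
    rw [e1, ev, ew]
    generalize Real.pi * (v - u) / ((n : ℝ) + 3) = x
    generalize Real.pi * (w - v) / ((n : ℝ) + 3) = y
    generalize 2 * Real.pi * u / ((n : ℝ) + 3) = z
    have expand : ∀ A B : ℝ,
        (Real.cos (z + A) - Real.cos z) * (Real.sin (z + (A + B)) - Real.sin z) -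
        (Real.sin (z + A) - Real.sin z) * (Real.cos (z + (A + B)) - Real.cos z) =
        Real.sin A + Real.sin B - Real.sin (A + B) := by
      intro A B
      have a1 : Real.sin A = Real.sin (z + A - z) := by congr 1; ring
      have a2 : Real.sin B = Real.sin (z + (A + B) - (z + A)) := by congr 1; ring
      have a3 : Real.sin (A + B) = Real.sin (z + (A + B) - z) := by congr 1; ring
      rw [a1, a2, a3]
      simp only [Real.sin_sub]
      ring
    rw [expand]
    simp only [Real.sin_add, Real.sin_two_mul, Real.cos_two_mul']
    have hx' : Real.cos x ^ 2 = 1 - Real.sin x ^ 2 := by linarith [Real.sin_sq_add_cos_sq x]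
    have hy' : Real.cos y ^ 2 = 1 - Real.sin y ^ 2 := by linarith [Real.sin_sq_add_cos_sq y]
    rw [hx', hy']
    ring
  rw [key]
  positivity

/-- A numbering of the vertices of the polygon in clockwise or counterclockwise order. -/
structure CyclicNumbering (n : ℕ) (p : Fin (n + 3) → ℕ) (ε : ℝ) : Prop where
  injective : Function.Injective p
  signedArea_pos : ∀ u v w, p u < p v → p v < p w →
    0 < ε * signedArea (vtx n u) (vtx n v) (vtx n w)
  succ_of_adj : ∀ u v, Adj n u v → p u < p v → p v = p u + 1 ∨ p u = 0

lemma signedArea_vtx_pos_of_cyclic (n : ℕ) {u v w : Fin (n + 3)}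
    (h : (u < v ∧ v < w) ∨ (v < w ∧ w < u) ∨ (w < u ∧ u < v)) :
    0 < signedArea (vtx n u) (vtx n v) (vtx n w) := by
  rcases h with ⟨h1, h2⟩ | ⟨h1, h2⟩ | ⟨h1, h2⟩
  · exact signedArea_vtx_pos n h1 h2
  · rw [signedArea_rotate]; exact signedArea_vtx_pos n h1 h2
  · rw [signedArea_rotate, signedArea_rotate]; exact signedArea_vtx_pos n h1 h2

lemma mod_cases_of_lt_two_mul {x N : ℕ} (h : x < 2 * N) :
    (x < N ∧ x % N = x) ∨ (N ≤ x ∧ x % N = x - N) := by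
  rcases lt_or_ge x N with h1 | h1
  · exact Or.inl ⟨h1, Nat.mod_eq_of_lt h1⟩
  · refine Or.inr ⟨h1, ?_⟩
    rw [Nat.mod_eq_sub_mod h1, Nat.mod_eq_of_lt (by omega)]

lemma cyclicNumbering_ccw (n : ℕ) (a : Fin (n + 3)) :
    CyclicNumbering n (fun x => (x.val + (n + 3) - a.val) % (n + 3)) 1 where
  injective := by
    intro u v h
    have hu := mod_cases_of_lt_two_mul (x := u.val + (n + 3) - a.val) (N := n + 3) (by omega)
    have hv := mod_cases_of_lt_two_mul (x := v.val + (n + 3) - a.val) (N := n + 3) (by omega)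
    simp only at h
    ext
    omega
  signedArea_pos := by
    intro u v w h1 h2
    have hu := mod_cases_of_lt_two_mul (x := u.val + (n + 3) - a.val) (N := n + 3) (by omega)
    have hv := mod_cases_of_lt_two_mul (x := v.val + (n + 3) - a.val) (N := n + 3) (by omega)
    have hw := mod_cases_of_lt_two_mul (x := w.val + (n + 3) - a.val) (N := n + 3) (by omega)
    rw [one_mul]
    apply signedArea_vtx_pos_of_cyclic
    simp only [Fin.lt_def]
    omega
  succ_of_adj := by
    intro u v hadj h
    have hu := mod_cases_of_lt_two_mul (x := u.val + (n + 3) - a.val) (N := n + 3) (by omega)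
    have hv := mod_cases_of_lt_two_mul (x := v.val + (n + 3) - a.val) (N := n + 3) (by omega)
    have hu' := mod_cases_of_lt_two_mul (x := u.val + 1) (N := n + 3) (by omega)
    have hv' := mod_cases_of_lt_two_mul (x := v.val + 1) (N := n + 3) (by omega)
    unfold Adj at hadj
    omega

lemma cyclicNumbering_cw (n : ℕ) (a : Fin (n + 3)) :
    CyclicNumbering n (fun x => (a.val + (n + 3) - x.val) % (n + 3)) (-1) where
  injective := by
    intro u v h
    have hu := mod_cases_of_lt_two_mul (x := a.val + (n + 3) - u.val) (N := n + 3) (by omega)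
    have hv := mod_cases_of_lt_two_mul (x := a.val + (n + 3) - v.val) (N := n + 3) (by omega)
    simp only at h
    ext
    omega
  signedArea_pos := by
    intro u v w h1 h2
    have hu := mod_cases_of_lt_two_mul (x := a.val + (n + 3) - u.val) (N := n + 3) (by omega)
    have hv := mod_cases_of_lt_two_mul (x := a.val + (n + 3) - v.val) (N := n + 3) (by omega)
    have hw := mod_cases_of_lt_two_mul (x := a.val + (n + 3) - w.val) (N := n + 3) (by omega)
    rw [signedArea_swap, neg_one_mul, neg_neg]
    apply signedArea_vtx_pos_of_cyclic
    simp only [Fin.lt_def]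
    omega
  succ_of_adj := by
    intro u v hadj h
    have hu := mod_cases_of_lt_two_mul (x := a.val + (n + 3) - u.val) (N := n + 3) (by omega)
    have hv := mod_cases_of_lt_two_mul (x := a.val + (n + 3) - v.val) (N := n + 3) (by omega)
    have hu' := mod_cases_of_lt_two_mul (x := u.val + 1) (N := n + 3) (by omega)
    have hv' := mod_cases_of_lt_two_mul (x := v.val + 1) (N := n + 3) (by omega)
    unfold Adj at hadj
    omega

lemma exists_cyclicNumbering (n : ℕ) {a b c : Fin (n + 3)} (hca : c ≠ a) (hba : b ≠ a)
    (hcb : c ≠ b) : ∃ p ε, CyclicNumbering n p ε ∧ p a = 0 ∧ p c < p b := by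
  have hca' : c.val ≠ a.val := fun h => hca (Fin.ext h)
  have hba' : b.val ≠ a.val := fun h => hba (Fin.ext h)
  have hcb' : c.val ≠ b.val := fun h => hcb (Fin.ext h)
  have h1 := mod_cases_of_lt_two_mul (x := c.val + (n + 3) - a.val) (N := n + 3) (by omega)
  have h2 := mod_cases_of_lt_two_mul (x := b.val + (n + 3) - a.val) (N := n + 3) (by omega)
  have h3 := mod_cases_of_lt_two_mul (x := a.val + (n + 3) - c.val) (N := n + 3) (by omega)
  have h4 := mod_cases_of_lt_two_mul (x := a.val + (n + 3) - b.val) (N := n + 3) (by omega)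
  by_cases h : (c.val + (n + 3) - a.val) % (n + 3) < (b.val + (n + 3) - a.val) % (n + 3)
  · exact ⟨_, _, cyclicNumbering_ccw n a, by simp, h⟩
  · exact ⟨_, _, cyclicNumbering_cw n a, by simp, by omega⟩

namespace CyclicNumbering

variable {n : ℕ} {p : Fin (n + 3) → ℕ} {ε : ℝ}

lemma signedArea_nonneg_of_outside (hp : CyclicNumbering n p ε) {u v w : Fin (n + 3)}
    (huv : p u < p v) (hw : p w ≤ p u ∨ p v ≤ p w) :
    0 ≤ ε * signedArea (vtx n u) (vtx n v) (vtx n w) ∧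
      (w ≠ u → w ≠ v → 0 < ε * signedArea (vtx n u) (vtx n v) (vtx n w)) := by
  by_cases h1 : w = u
  · subst h1; simp [signedArea_self_left]
  by_cases h2 : w = v
  · subst h2; simp [signedArea_self_right]
  have h1' : p w ≠ p u := fun h => h1 (hp.injective h)
  have h2' : p w ≠ p v := fun h => h2 (hp.injective h)
  have : 0 < ε * signedArea (vtx n u) (vtx n v) (vtx n w) := by
    rcases hw with hw | hw
    · rw [signedArea_rotate, signedArea_rotate]
      exact hp.signedArea_pos _ _ _ (by omega) huv
    · exact hp.signedArea_pos _ _ _ huv (by omega)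
  exact ⟨this.le, fun _ _ => this⟩

lemma signedArea_nonpos_of_inside (hp : CyclicNumbering n p ε) {u v w : Fin (n + 3)}
    (h1 : p u ≤ p w) (h2 : p w ≤ p v) :
    0 ≤ -(ε * signedArea (vtx n u) (vtx n v) (vtx n w)) ∧
      (w ≠ u → w ≠ v → 0 < -(ε * signedArea (vtx n u) (vtx n v) (vtx n w))) := by
  by_cases e1 : w = u
  · subst e1; simp [signedArea_self_left]
  by_cases e2 : w = v
  · subst e2; simp [signedArea_self_right]
  have h1' : p w ≠ p u := fun h => e1 (hp.injective h)
  have h2' : p w ≠ p v := fun h => e2 (hp.injective h)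
  have : 0 < -(ε * signedArea (vtx n u) (vtx n v) (vtx n w)) := by
    rw [signedArea_swap, mul_neg, neg_neg]
    exact hp.signedArea_pos _ _ _ (by omega) (by omega)
  exact ⟨this.le, fun _ _ => this⟩

lemma not_cross_of_same_side {P Q R S : EuclideanSpace ℝ (Fin 2)} {ε : ℝ}
    (h1 : 0 ≤ ε * signedArea P Q R) (h2 : 0 ≤ ε * signedArea P Q S)
    (h : 0 < ε * signedArea P Q R ∨ 0 < ε * signedArea P Q S) :
    ¬ (openSegment ℝ P Q ∩ openSegment ℝ R S).Nonempty := by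
  rintro ⟨x, hx, hx'⟩
  have h0 := signedArea_eq_zero_of_mem_openSegment hx
  obtain ⟨s, t, hs, ht, hst, rfl⟩ := hx'
  rw [signedArea_combo _ _ _ _ hst] at h0
  have h0' : s * (ε * signedArea P Q R) + t * (ε * signedArea P Q S) = 0 := by
    linear_combination ε * h0
  rcases h with h | h
  · nlinarith [mul_pos hs h, mul_nonneg ht.le h2]
  · nlinarith [mul_pos ht h, mul_nonneg hs.le h1]

lemma cross_of_interlaced (hp : CyclicNumbering n p ε) {u v w z : Fin (n + 3)}
    (h1 : p u < p w) (h2 : p w < p v) (h3 : p v < p z) : Cross n u v w z := by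
  have A := hp.signedArea_pos w v z h2 h3
  have B := hp.signedArea_pos u v z (h1.trans h2) h3
  have C := hp.signedArea_pos u w z h1 (h2.trans h3)
  have D := hp.signedArea_pos u w v h1 h2
  set A' := ε * signedArea (vtx n w) (vtx n v) (vtx n z) with hA
  set B' := ε * signedArea (vtx n u) (vtx n v) (vtx n z) with hB
  set C' := ε * signedArea (vtx n u) (vtx n w) (vtx n z) with hC
  set D' := ε * signedArea (vtx n u) (vtx n w) (vtx n v) with hD
  have hsum : A' + C' = B' + D' := by
    rw [hA, hB, hC, hD]; simp only [signedArea]; ring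
  have hpos : 0 < A' + C' := by positivity
  refine ⟨(A' / (A' + C')) • vtx n u + (C' / (A' + C')) • vtx n v,
    ⟨_, _, by positivity, by positivity, by field_simp, rfl⟩,
    ⟨B' / (A' + C'), D' / (A' + C'), by positivity, by positivity, ?_, ?_⟩⟩
  · rw [← add_div, ← hsum, div_self hpos.ne']
  · have : ∀ i : Fin 2, B' * vtx n w i + D' * vtx n z i = A' * vtx n u i + C' * vtx n v i := by
      intro i
      fin_cases i <;> simp only [hA, hB, hC, hD, signedArea, Fin.zero_eta, Fin.mk_one] <;> ring
    ext i
    simp only [PiLp.add_apply, PiLp.smul_apply, smul_eq_mul]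
    field_simp
    linear_combination this i

lemma cross_comm {n : ℕ} {u v w z : Fin (n + 3)} : Cross n u v w z ↔ Cross n w z u v := by
  simp only [Cross, Set.inter_comm]

lemma cross_iff (hp : CyclicNumbering n p ε) {u v w z : Fin (n + 3)}
    (huv : p u < p v) (hwz : p w < p z) :
    Cross n u v w z ↔ (p u = p w ∧ p v = p z) ∨ (p u < p w ∧ p w < p v ∧ p v < p z) ∨
      (p w < p u ∧ p u < p z ∧ p z < p v) := by
  constructor
  · intro h
    by_contra hcon
    have hne : ∀ x y, x ≠ y ↔ p x ≠ p y := fun x y => hp.injective.ne_iff.symm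
    have key : (p w ≤ p u ∨ p v ≤ p w) ∧ (p z ≤ p u ∨ p v ≤ p z) ∨
        (p u ≤ p w ∧ p w ≤ p v) ∧ (p u ≤ p z ∧ p z ≤ p v) := by omega
    have hstrict : (w ≠ u ∧ w ≠ v) ∨ (z ≠ u ∧ z ≠ v) := by
      simp only [hne]; omega
    rcases key with ⟨k1, k2⟩ | ⟨⟨k1, k2⟩, k3, k4⟩
    · have q1 := hp.signedArea_nonneg_of_outside huv k1
      have q2 := hp.signedArea_nonneg_of_outside huv k2
      exact not_cross_of_same_side q1.1 q2.1
        (hstrict.imp (fun h => q1.2 h.1 h.2) (fun h => q2.2 h.1 h.2)) h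
    · have q1 := hp.signedArea_nonpos_of_inside k1 k2
      have q2 := hp.signedArea_nonpos_of_inside k3 k4
      simp only [← neg_mul] at q1 q2
      exact not_cross_of_same_side q1.1 q2.1
        (hstrict.imp (fun h => q1.2 h.1 h.2) (fun h => q2.2 h.1 h.2)) h
  · rintro (⟨h1, h2⟩ | ⟨h1, h2, h3⟩ | ⟨h1, h2, h3⟩)
    · obtain rfl := hp.injective h1
      obtain rfl := hp.injective h2
      exact ⟨(1 / 2 : ℝ) • vtx n u + (1 / 2 : ℝ) • vtx n v,
        ⟨_, _, by norm_num, by norm_num, by norm_num, rfl⟩,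
        ⟨_, _, by norm_num, by norm_num, by norm_num, rfl⟩⟩
    · exact hp.cross_of_interlaced h1 h2 h3
    · exact cross_comm.1 (hp.cross_of_interlaced h1 h2 h3)

lemma dist_lt_dist (hp : CyclicNumbering n p ε) {w z u v u' v' : Fin (n + 3)}
    (h1 : p w < p u) (h2 : p u ≤ p u') (h3 : p u' < p z) (h4 : p z < p v') (h5 : p v' ≤ p v)
    (hne : p u ≠ p u' ∨ p v ≠ p v') {x y : EuclideanSpace ℝ (Fin 2)}
    (hx : x ∈ openSegment ℝ (vtx n u) (vtx n v)) (hx' : x ∈ openSegment ℝ (vtx n w) (vtx n z))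
    (hy : y ∈ openSegment ℝ (vtx n u') (vtx n v')) (hy' : y ∈ openSegment ℝ (vtx n w) (vtx n z)) :
    dist (vtx n w) x < dist (vtx n w) y := by
  have huv : p u < p v := by omega
  have hW := (hp.signedArea_nonneg_of_outside huv (w := w) (Or.inl h1.le)).2
    (fun h => by subst h; omega) (fun h => by subst h; omega)
  have q1 := hp.signedArea_nonpos_of_inside (u := u) (v := v) (w := u') h2 (by omega)
  have q2 := hp.signedArea_nonpos_of_inside (u := u) (v := v) (w := v') (by omega) h5
  have hY : 0 < -(ε * signedArea (vtx n u) (vtx n v) y) := by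
    obtain ⟨s, t, hs, ht, hst, rfl⟩ := hy
    rw [signedArea_combo _ _ _ _ hst]
    have hst' : p u' ≠ p u ∨ p v' ≠ p v := by omega
    rcases hst' with h | h
    · have := q1.2 (fun e => h (by rw [e])) (fun e => by subst e; omega)
      nlinarith [mul_pos hs this, mul_nonneg ht.le q2.1]
    · have := q2.2 (fun e => by subst e; omega) (fun e => h (by rw [e]))
      nlinarith [mul_pos ht this, mul_nonneg hs.le q1.1]
  have hX := signedArea_eq_zero_of_mem_openSegment hx
  have hZ := (hp.signedArea_nonpos_of_inside (u := u) (v := v) (w := z) (by omega) (by omega)).1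
  have hwz : 0 < dist (vtx n w) (vtx n z) := by
    rw [dist_pos]
    intro h
    rw [h] at hW
    linarith
  obtain ⟨s, t, hs, ht, hst, rfl⟩ := hx'
  obtain ⟨s', t', hs', ht', hst', rfl⟩ := hy'
  obtain rfl : s = 1 - t := by linarith
  obtain rfl : s' = 1 - t' := by linarith
  rw [signedArea_combo _ _ _ _ hst] at hX
  rw [signedArea_combo _ _ _ _ hst'] at hY
  have hd : ∀ r : ℝ, 0 < r → dist (vtx n w) ((1 - r) • vtx n w + r • vtx n z) =
      r * dist (vtx n w) (vtx n z) := by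
    intro r hr
    rw [dist_eq_norm, dist_eq_norm, show vtx n w - ((1 - r) • vtx n w + r • vtx n z) =
      r • (vtx n w - vtx n z) by module, norm_smul, Real.norm_of_nonneg hr.le]
  rw [hd t ht, hd t' ht']
  refine mul_lt_mul_of_pos_right ?_ hwz
  generalize signedArea (vtx n u) (vtx n v) (vtx n w) = α at *
  generalize signedArea (vtx n u) (vtx n v) (vtx n z) = ζ at *
  have hX' : (1 - t) * (ε * α) + t * (ε * ζ) = 0 := by linear_combination ε * hX
  by_contra hcon
  nlinarith

end CyclicNumbering

section

variable {n : ℕ} {T : Triangulation n} {p : Fin (n + 3) → ℕ} {ε : ℝ}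

lemma Adj.ne {u v : Fin (n + 3)} (h : Adj n u v) : u ≠ v := by
  rintro rfl
  have := mod_cases_of_lt_two_mul (x := u.val + 1) (N := n + 3) (by omega)
  unfold Adj at h
  omega

lemma Triangulation.src_ne_tgt (T : Triangulation n) (i : Fin (2 * n + 3)) :
    T.src i ≠ T.tgt i := by
  rcases lt_or_ge i.val n with h | h
  · exact (T.diag i h).1
  · exact (T.bdry i h).ne

/-- The smaller number of an endpoint of `T_i`. -/
def Triangulation.lo (T : Triangulation n) (p : Fin (n + 3) → ℕ) (i : Fin (2 * n + 3)) : ℕ :=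
  min (p (T.src i)) (p (T.tgt i))

/-- The larger number of an endpoint of `T_i`. -/
def Triangulation.hi (T : Triangulation n) (p : Fin (n + 3) → ℕ) (i : Fin (2 * n + 3)) : ℕ :=
  max (p (T.src i)) (p (T.tgt i))

lemma Joins.symm {i : Fin (2 * n + 3)} {u v : Fin (n + 3)} (h : Joins n T i u v) :
    Joins n T i v u := by
  unfold Joins SamePair at *
  tauto

lemma Joins.lo_hi {i : Fin (2 * n + 3)} {u v : Fin (n + 3)} (h : Joins n T i u v) :
    T.lo p i = min (p u) (p v) ∧ T.hi p i = max (p u) (p v) := by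
  unfold Joins SamePair at h
  rcases h with ⟨h1, h2⟩ | ⟨h1, h2⟩
  · simp [Triangulation.lo, Triangulation.hi, h1, h2]
  · simp [Triangulation.lo, Triangulation.hi, h1, h2, min_comm, max_comm]

lemma Joins.ne {i : Fin (2 * n + 3)} {u v : Fin (n + 3)} (h : Joins n T i u v) : u ≠ v := by
  have := T.src_ne_tgt i
  unfold Joins SamePair at h
  rcases h with ⟨h1, h2⟩ | ⟨h1, h2⟩
  · rwa [← h1, ← h2]
  · rw [← h1, ← h2]; exact this.symm

lemma Joins.right_unique {i : Fin (2 * n + 3)} {u v w : Fin (n + 3)} (h : Joins n T i u v)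
    (h' : Joins n T i u w) : v = w := by
  unfold Joins SamePair at h h'
  rcases h with ⟨h1, h2⟩ | ⟨h1, h2⟩ <;> rcases h' with ⟨h3, h4⟩ | ⟨h3, h4⟩ <;> grind

lemma Joins.edge_unique {i j : Fin (2 * n + 3)} {u v : Fin (n + 3)} (h : Joins n T i u v)
    (h' : Joins n T j u v) : i = j := by
  apply T.inj
  unfold Joins SamePair at h h'
  unfold SamePair
  rcases h with ⟨h1, h2⟩ | ⟨h1, h2⟩ <;> rcases h' with ⟨h3, h4⟩ | ⟨h3, h4⟩ <;> simp [*]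

/-- Every crossing point of `T_i` with the segment from `a` to `b` is closer to `a` than every
crossing point of `T_j`. -/
def CrossesBefore (n : ℕ) (T : Triangulation n) (a b : Fin (n + 3)) (i j : Fin (2 * n + 3)) :
    Prop :=
  ∀ x ∈ crossPts n T i a b, ∀ y ∈ crossPts n T j a b, dist (vtx n a) x < dist (vtx n a) y

lemma crossesBefore_of_not_ecross {a b : Fin (n + 3)} {i j : Fin (2 * n + 3)}
    (h : ¬ (ECross n T i a b ∧ ECross n T j a b)) : CrossesBefore n T a b i j :=
  fun x hx y hy => absurd ⟨⟨x, hx⟩, ⟨y, hy⟩⟩ h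

namespace CyclicNumbering

lemma exists_ends (hp : CyclicNumbering n p ε) (T : Triangulation n) (i : Fin (2 * n + 3)) :
    ∃ u v, p u = T.lo p i ∧ p v = T.hi p i ∧ p u < p v ∧
      openSegment ℝ (vtx n (T.src i)) (vtx n (T.tgt i)) = openSegment ℝ (vtx n u) (vtx n v) ∧
      Joins n T i u v := by
  have h : p (T.src i) ≠ p (T.tgt i) := fun h => T.src_ne_tgt i (hp.injective h)
  rcases lt_or_gt_of_ne h with h | h
  · exact ⟨T.src i, T.tgt i, by simp [Triangulation.lo, h.le], by simp [Triangulation.hi, h.le], h,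
      rfl, Or.inl ⟨rfl, rfl⟩⟩
  · exact ⟨T.tgt i, T.src i, by simp [Triangulation.lo, h.le], by simp [Triangulation.hi, h.le], h,
      openSegment_symm _ _ _, Or.inr ⟨rfl, rfl⟩⟩

lemma eq_of_lo_hi (hp : CyclicNumbering n p ε) {i j : Fin (2 * n + 3)}
    (h1 : T.lo p i = T.lo p j) (h2 : T.hi p i = T.hi p j) : i = j := by
  obtain ⟨u, v, hu, hv, h, -, hi⟩ := hp.exists_ends T i
  obtain ⟨u', v', hu', hv', h', -, hj⟩ := hp.exists_ends T j
  obtain rfl : u = u' := hp.injective (by omega)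
  obtain rfl : v = v' := hp.injective (by omega)
  exact hi.edge_unique hj

lemma ecross_iff (hp : CyclicNumbering n p ε) {i : Fin (2 * n + 3)} {w z : Fin (n + 3)}
    (hwz : p w < p z) : ECross n T i w z ↔
      (T.lo p i = p w ∧ T.hi p i = p z) ∨
      (T.lo p i < p w ∧ p w < T.hi p i ∧ T.hi p i < p z) ∨
      (p w < T.lo p i ∧ T.lo p i < p z ∧ p z < T.hi p i) := by
  obtain ⟨u, v, hu, hv, h, hseg, -⟩ := hp.exists_ends T i
  rw [ECross, Cross, hseg, ← hu, ← hv]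
  exact hp.cross_iff h hwz

lemma not_interlaced (hp : CyclicNumbering n p ε) (T : Triangulation n)
    (i j : Fin (2 * n + 3)) :
    ¬ (T.lo p i < T.lo p j ∧ T.lo p j < T.hi p i ∧ T.hi p i < T.hi p j) := by
  rintro ⟨h1, h2, h3⟩
  obtain ⟨u, v, hu, hv, h, hseg, -⟩ := hp.exists_ends T i
  obtain ⟨u', v', hu', hv', h', hseg', -⟩ := hp.exists_ends T j
  refine T.noncross i j (by rintro rfl; omega) ?_
  rw [Cross, hseg, hseg']
  exact (hp.cross_iff h h').2 (by omega)

lemma crossesBefore_of_nested (hp : CyclicNumbering n p ε) {i j : Fin (2 * n + 3)}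
    {w z : Fin (n + 3)} (hij : i ≠ j) (h1 : p w < T.lo p i) (h2 : T.lo p i ≤ T.lo p j)
    (h3 : T.lo p j < p z) (h4 : p z < T.hi p j) (h5 : T.hi p j ≤ T.hi p i) :
    CrossesBefore n T w z i j := by
  have hne : T.lo p i ≠ T.lo p j ∨ T.hi p i ≠ T.hi p j := by
    by_contra hcon
    push Not at hcon
    exact hij (hp.eq_of_lo_hi hcon.1 hcon.2)
  obtain ⟨u, v, hu, hv, h, hseg, -⟩ := hp.exists_ends T i
  obtain ⟨u', v', hu', hv', h', hseg', -⟩ := hp.exists_ends T j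
  rintro x ⟨hx, hx'⟩ y ⟨hy, hy'⟩
  rw [hseg] at hx
  rw [hseg'] at hy
  exact hp.dist_lt_dist (by omega) (by omega) (by omega) (by omega) (by omega) (by omega)
    hx hx' hy hy'

lemma crossesBefore_iff (hp : CyclicNumbering n p ε) {i j : Fin (2 * n + 3)}
    {w z : Fin (n + 3)} (hij : i ≠ j) (hi : p w < T.lo p i ∧ T.lo p i < p z ∧ p z < T.hi p i)
    (hj : p w < T.lo p j ∧ T.lo p j < p z ∧ p z < T.hi p j) :
    CrossesBefore n T w z i j ↔ T.lo p i ≤ T.lo p j ∧ T.hi p j ≤ T.hi p i := by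
  refine ⟨fun h => ?_, fun h => hp.crossesBefore_of_nested hij hi.1 h.1 hj.2.1 hj.2.2 h.2⟩
  by_contra hcon
  have n1 := hp.not_interlaced T i j
  have n2 := hp.not_interlaced T j i
  have hji := hp.crossesBefore_of_nested (w := w) (z := z) hij.symm hj.1 (by omega) hi.2.1 hi.2.2
    (by omega)
  have hwz : p w < p z := by omega
  obtain ⟨x, hx⟩ := (hp.ecross_iff (T := T) (i := i) hwz).2 (by omega)
  obtain ⟨y, hy⟩ := (hp.ecross_iff (T := T) (i := j) hwz).2 (by omega)
  exact lt_asymm (h x hx y hy) (hji y hy x hx)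

end CyclicNumbering

/-- A diagonal `cd` of `T` separates `a` from `b`, where the vertices are numbered from `a` on in
the order `a`, `c`, `b`, `d`, and no edge of `T` crosses the segment from `a` to `b` before `cd`. -/
structure FirstCrossing (n : ℕ) (T : Triangulation n) (p : Fin (n + 3) → ℕ)
    (a b c d : Fin (n + 3)) (i0 : Fin (2 * n + 3)) : Prop where
  injective : Function.Injective p
  a_eq : p a = 0
  a_lt_c : 0 < p c
  c_lt_b : p c < p b
  b_lt_d : p b < p d
  joins : Joins n T i0 c d
  eq_of_lo_hi : ∀ i j, T.lo p i = T.lo p j → T.hi p i = T.hi p j → i = j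
  not_interlaced : ∀ i j, ¬ (T.lo p i < T.lo p j ∧ T.lo p j < T.hi p i ∧ T.hi p i < T.hi p j)
  ecross_ab : ∀ i, ECross n T i a b ↔
    p c ≤ T.lo p i ∧ T.lo p i < p b ∧ p b < T.hi p i ∧ T.hi p i ≤ p d
  ecross_cb : ∀ i, ECross n T i c b ↔ (T.lo p i = p c ∧ T.hi p i = p b) ∨
    (p c < T.lo p i ∧ T.lo p i < p b ∧ p b < T.hi p i)
  before_ab : ∀ i j, i ≠ j → (CrossesBefore n T a b i j ↔
    (ECross n T i a b → ECross n T j a b → T.lo p i ≤ T.lo p j ∧ T.hi p j ≤ T.hi p i))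
  before_cb : ∀ i j, i ≠ j → (CrossesBefore n T c b i j ↔
    (ECross n T i c b → ECross n T j c b → T.lo p i ≤ T.lo p j ∧ T.hi p j ≤ T.hi p i))

lemma exists_firstCrossing {a b c d : Fin (n + 3)} {i0 : Fin (2 * n + 3)}
    (hab : a ≠ b) (hM : ¬ ∃ i : Fin (2 * n + 3), Joins n T i a b)
    (hi0M : ECross n T i0 a b)
    (hclosest : ∀ j : Fin (2 * n + 3), j.val < n → ECross n T j a b → j ≠ i0 →
      CrossesBefore n T a b i0 j)
    (hcd : Joins n T i0 c d) :
    ∃ p, FirstCrossing n T p a b c d i0 := by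
  have ab_not_edge : ∀ (p : Fin (n + 3) → ℕ) (ε : ℝ), CyclicNumbering n p ε → ∀ i,
      ¬ (T.lo p i = p a ∧ T.hi p i = p b) := by
    rintro p ε hp i ⟨h1, h2⟩
    obtain ⟨u, v, hu, hv, h, -, hj⟩ := hp.exists_ends T i
    obtain rfl : u = a := hp.injective (by omega)
    obtain rfl : v = b := hp.injective (by omega)
    exact hM ⟨i, hj⟩
  have cross_ab : ∀ (p : Fin (n + 3) → ℕ) (ε : ℝ), CyclicNumbering n p ε → p a = 0 → ∀ i,
      ECross n T i a b ↔ (0 < T.lo p i ∧ T.lo p i < p b ∧ p b < T.hi p i) := by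
    intro p ε hp h0 i
    have hb : p b ≠ p a := fun h => hab (hp.injective h).symm
    have := ab_not_edge p ε hp i
    rw [hp.ecross_iff (by omega)]
    omega
  have hcd_ne : c ≠ a ∧ c ≠ b := by
    have hp := cyclicNumbering_ccw n a
    have h0 := (cross_ab _ _ hp (by simp) i0).1 hi0M
    have h1 := hcd.lo_hi (p := fun x => (x.val + (n + 3) - a.val) % (n + 3))
    refine ⟨?_, ?_⟩
    · rintro rfl
      have : (c.val + (n + 3) - c.val) % (n + 3) = 0 := by simp
      omega
    · rintro rfl
      omega
  obtain ⟨p, ε, hp, ha, hcb⟩ := exists_cyclicNumbering n hcd_ne.1 hab.symm hcd_ne.2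
  have hX := cross_ab p ε hp ha
  have hlohi := hcd.lo_hi (p := p)
  have h0 := (hX i0).1 hi0M
  have hlo : T.lo p i0 = p c := by omega
  have hhi : T.hi p i0 = p d := by omega
  have nc := hp.not_interlaced T
  have ab_order : ∀ i, (0 < T.lo p i ∧ T.lo p i < p b ∧ p b < T.hi p i) →
      p c ≤ T.lo p i ∧ T.hi p i ≤ p d := by
    intro i hi
    by_cases h : i = i0
    · subst h; omega
    have hin : i.val < n := by
      by_contra hin
      push Not at hin
      obtain ⟨u, v, hu, hv, huv, -, hj⟩ := hp.exists_ends T i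
      have hadj : Adj n u v := by
        have := T.bdry i hin
        rcases hj with ⟨rfl, rfl⟩ | ⟨rfl, rfl⟩
        · exact this
        · exact this.symm
      have := hp.succ_of_adj u v hadj huv
      omega
    have := (hp.crossesBefore_iff (Ne.symm h) (by omega) (by omega)).1
      (hclosest i hin ((hX i).2 hi) h)
    omega
  have hX' : ∀ i, ECross n T i a b ↔
      p c ≤ T.lo p i ∧ T.lo p i < p b ∧ p b < T.hi p i ∧ T.hi p i ≤ p d := by
    intro i
    rw [hX]
    constructor
    · intro h
      have := ab_order i h
      omega
    · omega
  have hY : ∀ i, ECross n T i c b ↔ (T.lo p i = p c ∧ T.hi p i = p b) ∨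
      (p c < T.lo p i ∧ T.lo p i < p b ∧ p b < T.hi p i) := by
    intro i
    rw [hp.ecross_iff hcb]
    have := nc i i0
    omega
  refine ⟨p, hp.injective, ha, by omega, hcb, by omega, hcd,
    fun i j => hp.eq_of_lo_hi, nc, hX', hY, ?_, ?_⟩
  · intro i j hij
    by_cases h : ECross n T i a b ∧ ECross n T j a b
    · have h1 := (hX i).1 h.1
      have h2 := (hX j).1 h.2
      rw [hp.crossesBefore_iff hij (by omega) (by omega)]
      exact ⟨fun g _ _ => g, fun g => g h.1 h.2⟩
    · exact ⟨fun _ g1 g2 => absurd ⟨g1, g2⟩ h, fun _ => crossesBefore_of_not_ecross h⟩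
  · intro i j hij
    by_cases h : ECross n T i c b ∧ ECross n T j c b
    · have h1 := (hY i).1 h.1
      have h2 := (hY j).1 h.2
      have n1 := nc i j
      have n2 := nc j i
      have h3 : ¬ (T.lo p i = T.lo p j ∧ T.hi p i = T.hi p j) :=
        fun h => hij (hp.eq_of_lo_hi h.1 h.2)
      rw [hp.crossesBefore_iff hij (by omega) (by omega)]
      exact ⟨fun g _ _ => g, fun g => g h.1 h.2⟩
    · exact ⟨fun _ g1 g2 => absurd ⟨g1, g2⟩ h, fun _ => crossesBefore_of_not_ecross h⟩

/-- The walks of odd length from `u` to `v` along edges of `T` all of whose even steps satisfy `C`.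
The list of vertices leaves out the starting point `u`. -/
inductive AltWalk (T : Triangulation n) (C : Fin (2 * n + 3) → Prop) :
    Fin (n + 3) → Fin (n + 3) → List (Fin (n + 3)) → List (Fin (2 * n + 3)) → Prop
  | single {u v e} : Joins n T e u v → AltWalk T C u v [v] [e]
  | cons {u v w w' e e' vs es} : Joins n T e u w → Joins n T e' w w' → C e' →
      AltWalk T C w' v vs es → AltWalk T C u v (w :: w' :: vs) (e :: e' :: es)

namespace AltWalk

variable {C C' : Fin (2 * n + 3) → Prop}

lemma iff_forall (x₀ : Fin (n + 3)) (e₀ : Fin (2 * n + 3)) :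
    ∀ (u v : Fin (n + 3)) (vs : List (Fin (n + 3))) (es : List (Fin (2 * n + 3))),
    AltWalk T C u v vs es ↔ vs.length = es.length ∧ (u :: vs).getLast? = some v ∧
      (∀ k, k < es.length →
        Joins n T (es.getD k e₀) ((u :: vs).getD k x₀) ((u :: vs).getD (k + 1) x₀)) ∧
      Odd es.length ∧ (∀ k, k < es.length → k % 2 = 1 → C (es.getD k e₀))
  | u, v, vs, [] => by
    constructor
    · intro h; cases h
    · rintro ⟨-, -, -, h, -⟩; simp at h
  | u, v, [], e :: es => by
    constructor
    · intro h; cases h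
    · rintro ⟨h, -⟩; simp at h
  | u, v, [w], [e] => by
    constructor
    · intro h
      cases h with
      | single h => simpa using h
    · rintro ⟨-, h1, h2, -, -⟩
      have h3 := h2 0
      simp only [List.getLast?_cons_cons, List.getLast?_singleton, Option.some.injEq] at h1
      subst h1
      exact .single (by simpa using h3)
  | u, v, w :: w' :: vs, [e] => by
    constructor
    · intro h; cases h
    · rintro ⟨h, -⟩; simp at h
  | u, v, [w], e :: e' :: es => by
    constructor
    · intro h; cases h
    · rintro ⟨h, -⟩; simp at h
  | u, v, w :: w' :: vs, e :: e' :: es => by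
    have ih := iff_forall x₀ e₀ w' v vs es
    constructor
    · intro h
      cases h with
      | cons h1 h2 h3 h4 =>
        obtain ⟨g1, g2, g3, g4, g5⟩ := ih.1 h4
        refine ⟨by simpa using g1, by simpa using g2, ?_, ?_, ?_⟩
        · rintro (_ | _ | k) hk
          · simpa using h1
          · simpa using h2
          · simpa using g3 k (by simpa using hk)
        · simpa [Nat.odd_add] using g4
        · rintro (_ | _ | k) hk hk'
          · simp at hk'
          · simpa using h3
          · simpa using g5 k (by simpa using hk) (by omega)
    · rintro ⟨g1, g2, g3, g4, g5⟩
      refine .cons ?_ ?_ ?_ (ih.2 ⟨by simpa using g1, by simpa using g2, ?_, ?_, ?_⟩)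
      · simpa using g3 0 (by simp)
      · simpa using g3 1 (by simp)
      · simpa using g5 1 (by simp) (by simp)
      · intro k hk
        simpa using g3 (k + 2) (by simpa using hk)
      · simpa [Nat.odd_add] using g4
      · intro k hk hk'
        simpa using g5 (k + 2) (by simpa using hk) (by omega)

lemma imp {u v vs es} (h : AltWalk T C u v vs es) (hC : ∀ e ∈ es.tail, C e → C' e) :
    AltWalk T C' u v vs es := by
  induction h with
  | single h => exact .single h
  | cons h1 h2 h3 h4 ih =>
    refine .cons h1 h2 (hC _ (by simp) h3) (ih fun e he => hC e ?_)
    simp [List.mem_of_mem_tail he]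

lemma exists_head {u v vs es} (h : AltWalk T C u v vs es) (Q : Fin (n + 3) → Prop)
    (hQ : ∀ e x y, C e → Joins n T e x y → Q x) (hv : Q v) :
    ∃ e es' w vs', es = e :: es' ∧ vs = w :: vs' ∧ Joins n T e u w ∧ Q w ∧
      ∀ e' ∈ es', ∃ x y, Joins n T e' x y ∧ Q x ∧ Q y := by
  induction h with
  | single h => exact ⟨_, _, _, _, rfl, rfl, h, hv, by simp⟩
  | cons h1 h2 h3 h4 ih =>
    obtain ⟨e, es', w, vs', rfl, rfl, g1, g2, g3⟩ := ih hv
    have q1 := hQ _ _ _ h3 h2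
    have q2 := hQ _ _ _ h3 h2.symm
    refine ⟨_, _, _, _, rfl, rfl, h1, q1, ?_⟩
    simp only [List.mem_cons, forall_eq_or_imp]
    exact ⟨⟨_, _, h2, q1, q2⟩, ⟨_, _, g1, q2, g2⟩, g3⟩

end AltWalk

lemma mem_TPaths_iff {a b : Fin (n + 3)} {q : PathData n} :
    q ∈ TPaths n T a b ↔ ∃ vs, q.1 = a :: vs ∧ AltWalk T (fun i => ECross n T i a b) a b vs q.2 ∧
      q.2.Nodup ∧ q.2.Pairwise (CrossesBefore n T a b) := by
  obtain ⟨vs, es⟩ := q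
  have hpw : es.Pairwise (CrossesBefore n T a b) ↔ ∀ j k, j < k → k < es.length →
      CrossesBefore n T a b (es.getD j (edef n)) (es.getD k (edef n)) := by
    rw [List.pairwise_iff_getElem]
    constructor
    · intro h j k hjk hk
      simpa [List.getD_eq_getElem, hk, hjk.trans hk] using h j k (hjk.trans hk) hk hjk
    · intro h j k hj hk hjk
      simpa [List.getD_eq_getElem, hk, hj] using h j k hjk hk
  constructor
  · rintro ⟨h1, h2, h3, h4, h5, h6, h7, h8⟩
    cases vs with
    | nil => simp at h2
    | cons u vs =>
      simp only [List.head?_cons, Option.some.injEq] at h2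
      subst h2
      exact ⟨vs, rfl, (AltWalk.iff_forall u (edef n) _ _ _ _).2
        ⟨by simpa using h1, h3, h4, h6, h7⟩, h5, hpw.2 h8⟩
  · rintro ⟨vs, rfl, h1, h2, h3⟩
    obtain ⟨g1, g2, g3, g4, g5⟩ := (AltWalk.iff_forall a (edef n) _ _ _ _).1 h1
    exact ⟨by simpa using g1, rfl, g2, g3, h2, g4, g5, hpw.1 h3⟩

lemma finite_TPaths (n : ℕ) (T : Triangulation n) (a b : Fin (n + 3)) :
    (TPaths n T a b).Finite := by
  have h1 : {es : List (Fin (2 * n + 3)) | es.Nodup}.Finite :=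
    (List.finite_length_le _ (2 * n + 3)).subset fun es hes => by
      simpa using List.Nodup.length_le_card hes
  have h2 := List.finite_length_le (Fin (n + 3)) (2 * n + 3 + 1)
  refine (h2.prod h1).subset ?_
  rintro ⟨vs, es⟩ ⟨g1, -, -, -, g2, -⟩
  refine ⟨?_, g2⟩
  have := List.Nodup.length_le_card g2
  simp only [Fintype.card_fin] at this
  change vs.length = es.length + 1 at g1
  change vs.length ≤ 2 * n + 3 + 1
  omega

lemma X_ne_zero (n : ℕ) (i : Fin (2 * n + 3)) : X n i ≠ 0 := by
  rw [X, Ne, FaithfulSMul.algebraMap_eq_zero_iff]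
  exact MvPolynomial.X_ne_zero i

lemma pathX_cons (n : ℕ) (i : Fin (2 * n + 3)) (es : List (Fin (2 * n + 3))) :
    pathX n (i :: es) = X n i * (pathX n es)⁻¹ := by
  unfold pathX
  simp only [Finset.prod_filter, List.length_cons, Finset.prod_range_succ' _ es.length,
    List.getD_cons_succ, List.getD_cons_zero]
  have h1 : ∀ k : ℕ, (k + 1) % 2 = 0 ↔ k % 2 = 1 := by omega
  have h2 : ∀ k : ℕ, (k + 1) % 2 = 1 ↔ k % 2 = 0 := by omega
  simp only [h1, h2, mul_inv, inv_inv]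
  simp only [Nat.zero_mod, if_true, zero_ne_one, if_false]
  ring

/-- Turns a `T`-path from `c` to `b` into a `T`-path from `a` to `b` with first edge `i1 = ad`:
an initial step along `i0 = cd` is replaced by the step `i1`, and otherwise the two steps
`i1`, `i0` are prepended. -/
def extendPath (a d : Fin (n + 3)) (i0 i1 : Fin (2 * n + 3)) (q : PathData n) : PathData n :=
  if q.2.head? = some i0 then (a :: q.1.tail, i1 :: q.2.tail)
  else (a :: d :: q.1, i1 :: i0 :: q.2)

lemma pathX_extendPath (a d : Fin (n + 3)) (i0 i1 : Fin (2 * n + 3)) (q : PathData n) :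
    X n i1 * pathX n q.2 = pathX n (extendPath a d i0 i1 q).2 * X n i0 := by
  have h0 := X_ne_zero n i0
  obtain ⟨vs, es⟩ := q
  by_cases h : es.head? = some i0
  · cases es with
    | nil => simp at h
    | cons e es =>
      obtain rfl : e = i0 := by simpa using h
      simp only [extendPath, h, if_true, List.tail_cons, pathX_cons]
      ring
  · simp only [extendPath, h, if_false, pathX_cons, mul_inv, inv_inv]
    field_simp

namespace FirstCrossing

variable {a b c d : Fin (n + 3)} {i0 i1 : Fin (2 * n + 3)}

lemma lo_hi_i0 (h : FirstCrossing n T p a b c d i0) : T.lo p i0 = p c ∧ T.hi p i0 = p d := by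
  have h1 := h.c_lt_b
  have h2 := h.b_lt_d
  have h3 := h.joins.lo_hi (p := p)
  omega

/-- The even steps of a `T`-path from `c` to `b` are never the segment `cb` itself. -/
lemma altWalk_proper (h : FirstCrossing n T p a b c d i0) {vs es}
    (hw : AltWalk T (fun i => ECross n T i c b) c b vs es) (hnd : es.Nodup) :
    AltWalk T (fun i => p c < T.lo p i ∧ T.lo p i < p b ∧ p b < T.hi p i) c b vs es := by
  cases hw with
  | single h1 => exact .single h1
  | @cons _ _ w w' e e' vs es h1 h2 h3 h4 =>
    have he' : p c < T.lo p e' ∧ T.lo p e' < p b ∧ p b < T.hi p e' := by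
      refine ((h.ecross_cb e').1 h3).resolve_left ?_
      rintro ⟨g1, g2⟩
      have k1 := h2.lo_hi (p := p)
      have k2 : p w ≠ p c := fun k => h1.ne (h.injective k).symm
      have hcb := h.c_lt_b
      obtain rfl : w = b := h.injective (by omega)
      obtain rfl : w' = c := h.injective (by omega)
      obtain rfl := h1.edge_unique h2.symm
      simp at hnd
    refine (AltWalk.cons h1 h2 h3 h4).imp ?_
    intro x _ hx
    have := h.not_interlaced x e'
    have := (h.ecross_cb x).1 hx
    omega

lemma exists_head_cb (h : FirstCrossing n T p a b c d i0) {vs es}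
    (hw : AltWalk T (fun i => p c < T.lo p i ∧ T.lo p i < p b ∧ p b < T.hi p i) c b vs es) :
    ∃ e es' w vs', es = e :: es' ∧ vs = w :: vs' ∧ Joins n T e c w ∧ T.lo p e = p c ∧
      ∀ e' ∈ es', p c < T.lo p e' := by
  obtain ⟨e, es', w, vs', rfl, rfl, g1, g2, g3⟩ := hw.exists_head (fun x => p c < p x)
    (fun e x y he hj => by have := hj.lo_hi (p := p); omega) h.c_lt_b
  refine ⟨_, _, _, _, rfl, rfl, g1, ?_, ?_⟩
  · have := g1.lo_hi (p := p)
    omega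
  · intro e' he'
    obtain ⟨x, y, k1, k2, k3⟩ := g3 e' he'
    have := k1.lo_hi (p := p)
    omega

lemma ecross_ab_of_proper (h : FirstCrossing n T p a b c d i0) {i : Fin (2 * n + 3)}
    (hi : p c < T.lo p i ∧ T.lo p i < p b ∧ p b < T.hi p i) : ECross n T i a b := by
  have := h.not_interlaced i0 i
  have := h.lo_hi_i0
  have := h.b_lt_d
  rw [h.ecross_ab]
  omega

lemma ecross_ab_i0 (h : FirstCrossing n T p a b c d i0) : ECross n T i0 a b := by
  have := h.lo_hi_i0
  have := h.b_lt_d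
  have := h.c_lt_b
  rw [h.ecross_ab]
  omega

lemma not_ecross_ab_of_joins (h : FirstCrossing n T p a b c d i0) {x : Fin (n + 3)}
    {i : Fin (2 * n + 3)} (hi : Joins n T i a x) : ¬ ECross n T i a b := by
  have := hi.lo_hi (p := p)
  have := h.a_eq
  have := h.a_lt_c
  rw [h.ecross_ab]
  omega

lemma crossesBefore_ab_of_cb (h : FirstCrossing n T p a b c d i0) {i j : Fin (2 * n + 3)}
    (hij : i ≠ j) (hj : p c < T.lo p j) (hb : CrossesBefore n T c b i j) :
    CrossesBefore n T a b i j := by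
  rw [h.before_ab i j hij]
  intro k1 k2
  rw [h.before_cb i j hij] at hb
  rw [h.ecross_ab] at k1 k2
  rcases k1.1.eq_or_lt with k | k
  · have := h.not_interlaced i j
    omega
  · exact hb ((h.ecross_cb i).2 (by omega)) ((h.ecross_cb j).2 (by omega))

lemma crossesBefore_cb_of_ab (h : FirstCrossing n T p a b c d i0) {i j : Fin (2 * n + 3)}
    (hij : i ≠ j) (hb : CrossesBefore n T a b i j) : CrossesBefore n T c b i j := by
  rw [h.before_cb i j hij]
  intro k1 k2
  have n1 := h.not_interlaced i j
  have n2 := h.not_interlaced j i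
  have n3 := h.eq_of_lo_hi i j
  rw [h.ecross_cb] at k1 k2
  have k3 : ¬ (T.lo p i = T.lo p j ∧ T.hi p i = T.hi p j) := fun k => hij (n3 k.1 k.2)
  rw [h.before_ab i j hij] at hb
  exact hb (h.ecross_ab_of_proper (by omega)) (h.ecross_ab_of_proper (by omega))

lemma crossesBefore_ab_i0 (h : FirstCrossing n T p a b c d i0) {j : Fin (2 * n + 3)}
    (hj : i0 ≠ j) : CrossesBefore n T a b i0 j := by
  rw [h.before_ab i0 j hj]
  intro _ k
  have := h.lo_hi_i0
  rw [h.ecross_ab] at k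
  omega

lemma eq_i0_of_crossesBefore (h : FirstCrossing n T p a b c d i0) {j : Fin (2 * n + 3)}
    (hj : ECross n T j a b) (hb : CrossesBefore n T a b j i0) : j = i0 := by
  by_contra hne
  have h1 := (h.before_ab j i0 hne).1 hb hj h.ecross_ab_i0
  have := h.lo_hi_i0
  have := (h.ecross_ab j).1 hj
  exact hne (h.eq_of_lo_hi _ _ (by omega) (by omega))

lemma lo_zero_of_joins (h : FirstCrossing n T p a b c d i0) {x : Fin (n + 3)}
    {i : Fin (2 * n + 3)} (hi : Joins n T i a x) : T.lo p i = 0 := by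
  have := hi.lo_hi (p := p)
  have := h.a_eq
  omega

lemma extendPath_mem (h : FirstCrossing n T p a b c d i0) (hi1 : Joins n T i1 a d)
    {q : PathData n} (hq : q ∈ TPaths n T c b) :
    extendPath a d i0 i1 q ∈ TPathsFirst n T a b i1 := by
  obtain ⟨vs₀, es₀⟩ := q
  obtain ⟨vs, hvs, hw, hnd, hpw⟩ := mem_TPaths_iff.1 hq
  simp only at hvs hw hnd hpw
  subst hvs
  have hw' := h.altWalk_proper hw hnd
  obtain ⟨e, es, w, vs', rfl, rfl, g1, g2, g3⟩ := h.exists_head_cb hw'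
  have hac := h.a_lt_c
  have hlo1 := h.lo_zero_of_joins hi1
  have hlo0 := h.lo_hi_i0
  have hi1_before : ∀ j, CrossesBefore n T a b i1 j := fun j =>
    crossesBefore_of_not_ecross fun k => h.not_ecross_ab_of_joins hi1 k.1
  have hes : es.Pairwise (CrossesBefore n T a b) := by
    rw [List.nodup_cons] at hnd
    rw [List.pairwise_cons] at hpw
    refine List.Pairwise.imp_of_mem ?_ (hnd.2.and hpw.2)
    intro x y _ hy hxy
    exact h.crossesBefore_ab_of_cb hxy.1 (g3 y hy) hxy.2
  have hi1es : i1 ∉ es := fun k => by have := g3 _ k; omega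
  have hwab := hw'.imp (C' := fun i => ECross n T i a b) fun i _ hi => h.ecross_ab_of_proper hi
  rw [TPathsFirst, Set.mem_sep_iff, mem_TPaths_iff]
  by_cases he : e = i0
  · subst he
    obtain rfl := g1.right_unique h.joins
    simp only [extendPath, List.head?_cons, if_true, List.tail_cons, and_true]
    refine ⟨_, rfl, ?_, ?_, ?_⟩
    · cases hwab with
      | single => exact .single hi1
      | cons _ k2 k3 k4 => exact .cons hi1 k2 k3 k4
    · exact List.nodup_cons.2 ⟨hi1es, (List.nodup_cons.1 hnd).2⟩
    · exact List.pairwise_cons.2 ⟨fun j _ => hi1_before j, hes⟩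
  · simp only [extendPath, List.head?_cons, Option.some.injEq, he, if_false, and_true]
    refine ⟨_, rfl, .cons hi1 h.joins.symm h.ecross_ab_i0 hwab, ?_, ?_⟩
    · refine List.nodup_cons.2 ⟨?_, List.nodup_cons.2 ⟨?_, hnd⟩⟩
      · simp only [List.mem_cons, not_or]
        refine ⟨?_, ?_, hi1es⟩ <;> rintro rfl <;> omega
      · simp only [List.mem_cons, not_or]
        exact ⟨Ne.symm he, fun k => by have := g3 _ k; omega⟩
    · refine List.pairwise_cons.2 ⟨fun j _ => hi1_before j, List.pairwise_cons.2 ⟨?_, ?_⟩⟩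
      · intro j hj
        refine h.crossesBefore_ab_i0 ?_
        rintro rfl
        rcases List.mem_cons.1 hj with k | k
        · exact he k.symm
        · have := g3 _ k; omega
      · refine List.pairwise_cons.2 ⟨fun j hj => ?_, hes⟩
        refine h.crossesBefore_ab_of_cb ?_ (g3 j hj) ((List.pairwise_cons.1 hpw).1 j hj)
        rintro rfl
        exact (List.nodup_cons.1 hnd).1 hj

lemma extendPath_injOn : Set.InjOn (extendPath a d i0 i1) (TPaths n T c b) := by
  rintro ⟨vs₀, es₀⟩ hq ⟨vs₀', es₀'⟩ hq' heq
  obtain ⟨vs, hvs, hw, hnd, -⟩ := mem_TPaths_iff.1 hq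
  obtain ⟨vs', hvs', hw', hnd', -⟩ := mem_TPaths_iff.1 hq'
  simp only at hvs hvs' hnd hnd'
  subst hvs hvs'
  rcases es₀ with _ | ⟨e, es⟩
  · cases hw
  rcases es₀' with _ | ⟨e', es'⟩
  · cases hw'
  simp only [extendPath, List.head?_cons, Option.some.injEq, List.tail_cons] at heq
  split_ifs at heq with h1 h2 h2
  · simp_all
  · simp only [Prod.mk.injEq, List.cons.injEq, true_and] at heq
    simp_all
  · simp only [Prod.mk.injEq, List.cons.injEq, true_and] at heq
    rw [← heq.2, h2] at hnd'
    simp at hnd'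
  · simp_all

lemma lo_gt_of_crossesBefore (h : FirstCrossing n T p a b c d i0) {i j : Fin (2 * n + 3)}
    (hij : i ≠ j) (hi : ECross n T i a b) (hlo : p c < T.lo p i) (hj : ECross n T j a b)
    (hb : CrossesBefore n T a b i j) :
    p c < T.lo p j := by
  have := (h.before_ab i j hij).1 hb hi hj
  omega

lemma ecross_cb_of_lo_gt (h : FirstCrossing n T p a b c d i0) {i : Fin (2 * n + 3)}
    (hi : ECross n T i a b) (hlo : p c < T.lo p i) : ECross n T i c b := by
  rw [h.ecross_ab] at hi
  rw [h.ecross_cb]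
  omega

lemma extendPath_surjOn (h : FirstCrossing n T p a b c d i0) (hi1 : Joins n T i1 a d) :
    Set.SurjOn (extendPath a d i0 i1) (TPaths n T c b) (TPathsFirst n T a b i1) := by
  rintro ⟨vs₀, es₀⟩ ⟨hq, hfirst⟩
  obtain ⟨vs, hvs, hw, hnd, hpw⟩ := mem_TPaths_iff.1 hq
  simp only at hvs hw hnd hpw hfirst
  subst hvs
  have cb_of_ab : ∀ {es : List (Fin (2 * n + 3))}, es.Nodup →
      es.Pairwise (CrossesBefore n T a b) → es.Pairwise (CrossesBefore n T c b) :=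
    fun k1 k2 => (k1.and k2).imp fun k => h.crossesBefore_cb_of_ab k.1 k.2
  cases hw with
  | single h1 =>
    obtain rfl : _ = i1 := by simpa using hfirst
    have hbd := h.b_lt_d
    obtain rfl := h1.right_unique hi1
    omega
  | @cons _ _ w w' e e' vs es h1 h2 h3 h4 =>
    obtain rfl : e = i1 := by simpa using hfirst
    obtain rfl := h1.right_unique hi1
    obtain ⟨-, hnd2⟩ := List.nodup_cons.1 hnd
    obtain ⟨he', hnd3⟩ := List.nodup_cons.1 hnd2
    obtain ⟨-, hpw2⟩ := List.pairwise_cons.1 hpw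
    obtain ⟨hpe', hpw3⟩ := List.pairwise_cons.1 hpw2
    by_cases hei : e' = i0
    · subst hei
      obtain rfl := h2.right_unique h.joins.symm
      refine ⟨(w' :: vs, es), mem_TPaths_iff.2 ⟨vs, rfl, ?_, hnd3, cb_of_ab hnd3 hpw3⟩, ?_⟩
      · cases h4 with
        | single k => exact .single k
        | @cons _ _ x x' f f' vs es k1 k2 k3 k4 =>
          obtain ⟨hf, hnd4⟩ := List.nodup_cons.1 hnd3
          obtain ⟨hf', -⟩ := List.nodup_cons.1 hnd4
          have hlo : p w' < T.lo p f' := by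
            have q1 := ((h.ecross_ab f').1 k3).1
            refine lt_of_le_of_ne q1 fun q2 => ?_
            have q3 := k2.lo_hi (p := p)
            have q4 : p x ≠ p w' := fun q => k1.ne (h.injective q).symm
            obtain rfl : x' = w' := h.injective (by omega)
            obtain rfl := k1.edge_unique k2.symm
            simp at hf
          refine (AltWalk.cons k1 k2 k3 k4).imp fun g hg hg' => ?_
          refine h.ecross_cb_of_lo_gt hg' ?_
          rcases List.mem_cons.1 hg with rfl | hg
          · exact hlo
          · exact h.lo_gt_of_crossesBefore (by rintro rfl; exact hf' hg) k3 hlo hg'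
              ((List.pairwise_cons.1 (List.pairwise_cons.1 hpw3).2).1 g hg)
      · have : es.head? ≠ some e' := fun k => he' (List.mem_of_head? k)
        simp [extendPath, this]
    · have hlo0 := h.lo_hi_i0
      have hlo : p c < T.lo p e' := by
        have q1 := (h.ecross_ab e').1 h3
        refine lt_of_le_of_ne q1.1 fun q2 => hei ?_
        have q3 := h2.lo_hi (p := p)
        exact h.eq_of_lo_hi _ _ (by omega) (by omega)
      have hi0 : i0 ∉ e' :: es := by
        intro k
        rcases List.mem_cons.1 k with k | k
        · exact hei k.symm
        · exact hei (h.eq_i0_of_crossesBefore h3 (hpe' _ k))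
      have hnd' : (i0 :: e' :: es).Nodup := List.nodup_cons.2 ⟨hi0, hnd2⟩
      refine ⟨(c :: w :: w' :: vs, i0 :: e' :: es),
        mem_TPaths_iff.2 ⟨_, rfl, ?_, hnd', cb_of_ab hnd' ?_⟩, ?_⟩
      · refine (AltWalk.cons h.joins h2 h3 h4).imp fun g hg hg' => ?_
        refine h.ecross_cb_of_lo_gt hg' ?_
        rcases List.mem_cons.1 hg with rfl | hg
        · exact hlo
        · exact h.lo_gt_of_crossesBefore (by rintro rfl; exact he' hg) h3 hlo hg' (hpe' g hg)
      · exact List.pairwise_cons.2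
          ⟨fun j hj => h.crossesBefore_ab_i0 fun q => hi0 (q ▸ hj), hpw2⟩
      · simp [extendPath]

lemma finsum_TPathsFirst (h : FirstCrossing n T p a b c d i0) (hi1 : Joins n T i1 a d) :
    (∑ᶠ α ∈ TPathsFirst n T a b i1, pathX n α.2) * X n i0 =
      X n i1 * ∑ᶠ γ ∈ TPaths n T c b, pathX n γ.2 := by
  rw [finsum_mem_mul, mul_finsum_mem]
  exact (finsum_mem_eq_of_bijOn (extendPath a d i0 i1)
    ⟨fun q hq => h.extendPath_mem hi1 hq, extendPath_injOn, h.extendPath_surjOn hi1⟩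
    fun q _ => pathX_extendPath a d i0 i1 q).symm

lemma head_eq (h : FirstCrossing n T p a b c d i0) {i1' : Fin (2 * n + 3)}
    (hM : ¬ ∃ i : Fin (2 * n + 3), Joins n T i a b)
    (hi1' : Joins n T i1' a c) (hi1 : Joins n T i1 a d) {q : PathData n}
    (hq : q ∈ TPaths n T a b) : q.2.head? = some i1 ∨ q.2.head? = some i1' := by
  obtain ⟨vs₀, es₀⟩ := q
  obtain ⟨vs, hvs, hw, -, -⟩ := mem_TPaths_iff.1 hq
  simp only at hvs hw
  cases hw with
  | single h1 => exact absurd ⟨_, h1⟩ hM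
  | @cons _ _ w w' e e' vs es h1 h2 h3 h4 =>
    have q1 := (h.ecross_ab e').1 h3
    have q2 := h2.lo_hi (p := p)
    have q3 := h1.lo_hi (p := p)
    have q4 := h.a_eq
    have q5 := h.a_lt_c
    have q6 := h.lo_hi_i0
    have q7 := h.not_interlaced e i0
    have q8 : w = d ∨ w = c := by
      by_cases k : p w = p d
      · exact Or.inl (h.injective k)
      · exact Or.inr (h.injective (by omega))
    rcases q8 with rfl | rfl
    · exact Or.inl (by simp [h1.edge_unique hi1])
    · exact Or.inr (by simp [h1.edge_unique hi1'])

end FirstCrossing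

end

/-- exchange-relation form of Theorem 1. -/
theorem sum_TPaths_exchange_relation
    (n : ℕ) (hn : 1 ≤ n) (T : Triangulation n) (a b c d : Fin (n + 3))
    (i0 i1 i1' : Fin (2 * n + 3))
    (hab : a ≠ b) (hnadj : ¬ Adj n a b)
    (hM : ¬ ∃ i : Fin (2 * n + 3), Joins n T i a b)
    (hi0d : i0.val < n) (hi0M : ECross n T i0 a b)
    (hclosest : ∀ j : Fin (2 * n + 3), j.val < n → ECross n T j a b → j ≠ i0 →
      ∀ x ∈ crossPts n T i0 a b, ∀ y ∈ crossPts n T j a b,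
        dist (vtx n a) x < dist (vtx n a) y)
    (hcd : Joins n T i0 c d)
    (hi1' : Joins n T i1' a c) (hi1 : Joins n T i1 a d) :
    (∑ᶠ α ∈ TPaths n T a b, pathX n α.2) * X n i0 =
      X n i1 * (∑ᶠ γ ∈ TPaths n T c b, pathX n γ.2) +
      X n i1' * (∑ᶠ γ ∈ TPaths n T d b, pathX n γ.2) := by
  obtain ⟨p, hp⟩ := exists_firstCrossing hab hM hi0M hclosest hcd
  obtain ⟨p', hp'⟩ := exists_firstCrossing hab hM hi0M hclosest hcd.symm
  have hunion : TPaths n T a b = TPathsFirst n T a b i1 ∪ TPathsFirst n T a b i1' := by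
    ext q
    simp only [TPathsFirst, Set.mem_union, Set.mem_sep_iff, ← and_or_left]
    exact ⟨fun hq => ⟨hq, hp.head_eq hM hi1' hi1 hq⟩, fun hq => hq.1⟩
  have hdisj : Disjoint (TPathsFirst n T a b i1) (TPathsFirst n T a b i1') := by
    rw [Set.disjoint_left]
    rintro q ⟨-, h1⟩ ⟨-, h2⟩
    rw [h1, Option.some.injEq] at h2
    subst h2
    exact hcd.ne (hi1'.right_unique hi1)
  have hfin := finite_TPaths n T a b
  rw [hunion, finsum_mem_union hdisj (hfin.subset (Set.sep_subset _ _))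
    (hfin.subset (Set.sep_subset _ _)), add_mul, hp.finsum_TPathsFirst hi1,
    hp'.finsum_TPathsFirst hi1']
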